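/- arXiv:2507.17362 — 2 statements merged into one kernel-verified Lean document; each statement's English description precedes it below -/
import Mathlib

section
/- Multiplicative Horn problem in PU(1,1): Let α, β, γ ∈ (0,2π) and σ = α+β+γ. (1) There exist A, B, C ∈ U(1,1) of elliptic types α, β, γ respectively with A·B·C = λ·I₂ for some λ ∈ ℂ if and only if σ ≤ 2π or σ ≥ 4π. (2) There exist A, B, C ∈ SU(1,1), conjugate in U(1,1) to ℓ(α), ℓ(β), ℓ(γ) respectively, with A·B·C = −I₂ if and only if σ ≤ 2π; and there exist such A, B, C with A·B·C = I₂ if and only if σ ≥ 4π. -/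
open Real Matrix

noncomputable section

abbrev M2c : Type := Matrix (Fin 2) (Fin 2) ℂ

/-- The form J₁ = diag(1, −1). -/
def J1 : M2c := Matrix.diagonal ![1, -1]

/-- Membership in U(1,1). -/
def memU11 (M : M2c) : Prop := Mᴴ * J1 * M = J1

/-- `M ∈ U(1,1)` is of elliptic type `a`: conjugate in U(1,1) to diag(e^{ia}, 1). -/
def ellType11 (M : M2c) (a : ℝ) : Prop :=
  ∃ P : M2c, memU11 P ∧
    M = P * Matrix.diagonal ![Complex.exp (a * Complex.I), 1] * P⁻¹

/-- The standard lift ℓ(a) = diag(e^{ia/2}, e^{−ia/2}) ∈ SU(1,1). -/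
def lift11 (a : ℝ) : M2c :=
  Matrix.diagonal ![Complex.exp ((a / 2) * Complex.I), Complex.exp ((-a / 2) * Complex.I)]


def TT (a : ℝ) (X : M2c) : Prop := ∃ P : M2c, memU11 P ∧ X = P * lift11 a * P⁻¹

lemma J1_sq : J1 * J1 = 1 := by
  ext i j; fin_cases i <;> fin_cases j <;> simp [J1]

lemma J1_herm : J1ᴴ = J1 := by
  ext i j; fin_cases i <;> fin_cases j <;> simp [J1]

lemma mem_left {P : M2c} (h : memU11 P) : (J1 * Pᴴ * J1) * P = 1 := by
  unfold memU11 at h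
  rw [mul_assoc J1, mul_assoc J1, h, J1_sq]

lemma mem_right {P : M2c} (h : memU11 P) : P * (J1 * Pᴴ * J1) = 1 :=
  mul_eq_one_comm.mp (mem_left h)

lemma mem_inv_eq {P : M2c} (h : memU11 P) : P⁻¹ = J1 * Pᴴ * J1 :=
  Matrix.inv_eq_left_inv (mem_left h)

lemma mem_inv_mul {P : M2c} (h : memU11 P) : P⁻¹ * P = 1 := by
  rw [mem_inv_eq h, mem_left h]

lemma mem_mul_inv {P : M2c} (h : memU11 P) : P * P⁻¹ = 1 := by
  rw [mem_inv_eq h, mem_right h]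

lemma mem_flip {P : M2c} (h : memU11 P) : P * J1 * Pᴴ = J1 := by
  have := mem_right h
  calc P * J1 * Pᴴ = (P * (J1 * Pᴴ * J1)) * J1 := by
        simp only [mul_assoc, J1_sq, mul_one]
    _ = J1 := by rw [this, one_mul]

lemma mem_mul {P Q : M2c} (hP : memU11 P) (hQ : memU11 Q) : memU11 (P * Q) := by
  unfold memU11 at *
  calc (P * Q)ᴴ * J1 * (P * Q) = Qᴴ * (Pᴴ * J1 * P) * Q := by
        simp only [conjTranspose_mul, mul_assoc]
    _ = J1 := by rw [hP, hQ]

lemma mem_one : memU11 1 := by simp [memU11]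

lemma mem_inv {P : M2c} (h : memU11 P) : memU11 P⁻¹ := by
  have h2 := mem_flip h
  rw [mem_inv_eq h]
  unfold memU11
  calc (J1 * Pᴴ * J1)ᴴ * J1 * (J1 * Pᴴ * J1)
      = J1 * P * (J1 * J1) * J1 * Pᴴ * J1 := by
        simp only [conjTranspose_mul, conjTranspose_conjTranspose, J1_herm, mul_assoc]
    _ = J1 * (P * J1 * Pᴴ) * J1 := by rw [J1_sq]; simp only [mul_one, mul_assoc]
    _ = J1 := by rw [h2, J1_sq, one_mul]

lemma lift_eq (a : ℝ) : lift11 a = !![(cos (a/2) : ℂ) + sin (a/2) * Complex.I, 0; 0,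
    (cos (a/2) : ℂ) - sin (a/2) * Complex.I] := by
  have h1 : Complex.exp ((a / 2) * Complex.I) = (cos (a/2) : ℂ) + sin (a/2) * Complex.I := by
    rw [Complex.exp_mul_I]; push_cast; rfl
  have h2 : Complex.exp ((-a / 2) * Complex.I) = (cos (a/2) : ℂ) - sin (a/2) * Complex.I := by
    rw [Complex.exp_mul_I, neg_div, Complex.cos_neg, Complex.sin_neg]; push_cast; ring
  ext i j; fin_cases i <;> fin_cases j <;> simp [lift11, h1, h2]

lemma csq (a : ℝ) : (cos a : ℂ)^2 + (sin a : ℂ)^2 = 1 := by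
  exact_mod_cast Real.cos_sq_add_sin_sq a

lemma lift_mem (a : ℝ) : memU11 (lift11 a) := by
  have h := csq (a/2)
  have hI := Complex.I_sq
  unfold memU11
  rw [lift_eq]
  ext i j
  fin_cases i <;> fin_cases j <;>
    simp [J1, Matrix.mul_apply, -Complex.ofReal_cos, -Complex.ofReal_sin]
  · linear_combination h - (sin (a/2) : ℂ)^2 * hI
  · linear_combination -h + (sin (a/2) : ℂ)^2 * hI

lemma lift_det (a : ℝ) : (lift11 a).det = 1 := by
  have h := csq (a/2)
  have hI := Complex.I_sq
  rw [lift_eq, Matrix.det_fin_two_of]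
  linear_combination h - (sin (a/2) : ℂ)^2 * hI

lemma TT_mem {a : ℝ} {X : M2c} (h : TT a X) : memU11 X := by
  obtain ⟨P, hP, rfl⟩ := h
  exact mem_mul (mem_mul hP (lift_mem a)) (mem_inv hP)

lemma TT_det {a : ℝ} {X : M2c} (h : TT a X) : X.det = 1 := by
  obtain ⟨P, hP, rfl⟩ := h
  have : P.det * P⁻¹.det = 1 := by rw [← det_mul, mem_mul_inv hP, det_one]
  rw [det_mul, det_mul, lift_det]
  linear_combination this

lemma TT_conj {a : ℝ} {X Q : M2c} (hQ : memU11 Q) (h : TT a X) : TT a (Q⁻¹ * X * Q) := by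
  obtain ⟨P, hP, rfl⟩ := h
  refine ⟨Q⁻¹ * P, mem_mul (mem_inv hQ) hP, ?_⟩
  rw [Matrix.mul_inv_rev, Matrix.nonsing_inv_nonsing_inv]
  · simp only [mul_assoc]
  · exact Matrix.isUnit_det_of_left_inverse (mem_inv_mul hQ)

/-- the diagonal entries of an elliptic element -/
lemma TT_entry {a : ℝ} {X : M2c} (h : TT a X) : ∃ p : ℝ, 1 ≤ p ∧
    X 0 0 = cos (a/2) + sin (a/2) * p * Complex.I ∧
    X 1 1 = cos (a/2) - sin (a/2) * p * Complex.I := by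
  obtain ⟨P, hP, rfl⟩ := h
  have h1 := mem_flip hP
  have h2 := hP
  unfold memU11 at h2
  rw [mem_inv_eq hP, lift_eq]
  obtain ⟨x, y, z, w, rfl⟩ : ∃ x y z w : ℂ, P = !![x, y; z, w] :=
    ⟨_, _, _, _, Matrix.eta_fin_two P⟩
  have e00 := congrFun (congrFun h1 0) 0
  have e11 := congrFun (congrFun h1 1) 1
  have f11 := congrFun (congrFun h2 1) 1
  have ny := Complex.mul_conj y
  simp [J1, Matrix.mul_apply, Fin.sum_univ_two, -Complex.ofReal_cos, -Complex.ofReal_sin,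
    Matrix.vecMul_diagonal] at e00 e11 f11 ⊢
  refine ⟨1 + 2 * Complex.normSq y, by nlinarith [Complex.normSq_nonneg y], ?_, ?_⟩
  all_goals
    push_cast
    rw [← ny]
  · linear_combination (Complex.cos (a/2) + Complex.sin (a/2) * Complex.I) * e00
  · linear_combination -(Complex.cos (a/2) + Complex.sin (a/2) * Complex.I) * e11
      + 2 * Complex.sin (a/2) * Complex.I * f11

lemma TT_of {a p : ℝ} {q : ℂ} (hp : 0 < p) (h : p^2 = 1 + Complex.normSq q) :
    TT a !![(cos (a/2) : ℂ) + sin (a/2) * p * Complex.I, sin (a/2) * q * Complex.I;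
      - (sin (a/2) * (starRingEnd ℂ) q * Complex.I), (cos (a/2) : ℂ) - sin (a/2) * p * Complex.I] := by
  obtain ⟨u, hu, hu2⟩ : ∃ u : ℝ, 0 < u ∧ u^2 = (p+1)/2 :=
    ⟨√((p+1)/2), by positivity, Real.sq_sqrt (by positivity)⟩
  have hu0 : (u:ℂ) ≠ 0 := by exact_mod_cast hu.ne'
  obtain ⟨v, hv⟩ : ∃ v : ℂ, q = -(2 * u * v) := ⟨-q/(2*u), by field_simp⟩
  have hv' : (starRingEnd ℂ) q = -(2 * u * (starRingEnd ℂ) v) := by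
    have h2 : (starRingEnd ℂ) 2 = 2 := Complex.conj_ofNat 2
    rw [hv]; simp [h2]
  have hvv : Complex.normSq v = u^2 - 1 := by
    rw [hv, Complex.normSq_neg, Complex.normSq_mul, Complex.normSq_mul, Complex.normSq_ofReal] at h
    simp at h
    have : 4 * u^2 * (Complex.normSq v - (u^2 - 1)) = 0 := by
      have : p = 2 * u^2 - 1 := by linarith
      subst this
      linarith
    have h3 : 4 * u^2 ≠ 0 := by positivity
    have := (mul_eq_zero.mp this).resolve_left h3
    linarith
  have hvc : v * (starRingEnd ℂ) v = u^2 - 1 := by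
    rw [Complex.mul_conj, hvv]; push_cast; rfl
  have hpu : (p:ℂ) = 2 * u^2 - 1 := by
    have : p = 2 * u^2 - 1 := by linarith
    rw [this]; push_cast; rfl
  have hm : memU11 !![(u:ℂ), v; (starRingEnd ℂ) v, u] := by
    unfold memU11
    ext i j
    fin_cases i <;> fin_cases j <;>
      simp [J1, Matrix.mul_apply]
    · linear_combination -hvc
    · ring
    · ring
    · linear_combination hvc
  refine ⟨_, hm, ?_⟩
  rw [mem_inv_eq hm, lift_eq, hv', hv, hpu]
  ext i j
  fin_cases i <;> fin_cases j <;>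
    simp [J1, Matrix.mul_apply]
  · linear_combination -(Complex.cos (a/2) - Complex.sin (a/2) * Complex.I) * (-hvc)
  · ring
  · ring
  · linear_combination (Complex.cos (a/2) + Complex.sin (a/2) * Complex.I) * hvc

lemma neg_one_nec {α β γ : ℝ} (hα : 0 < α ∧ α < 2 * π) (hβ : 0 < β ∧ β < 2 * π)
    (hγ : 0 < γ ∧ γ < 2 * π) {A B C : M2c} (hA : TT α A) (hB : TT β B) (hC : TT γ C)
    (h : A * B * C = -1) : α + β + γ ≤ 2 * π := by
  obtain ⟨P, hP, rfl⟩ := hA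
  have hB' := TT_conj hP hB
  have hC' := TT_conj hP hC
  set B' := P⁻¹ * B * P with hBd
  set C' := P⁻¹ * C * P with hCd
  have h' : lift11 α * B' * C' = -1 := by
    calc lift11 α * B' * C' = (P⁻¹ * P) * lift11 α * P⁻¹ * B * (P * P⁻¹) * C * P := by
          rw [mem_inv_mul hP, hBd, hCd]; simp only [mul_assoc, one_mul]
      _ = P⁻¹ * (P * lift11 α * P⁻¹ * B * C) * P := by
          rw [mem_mul_inv hP]; simp only [mul_assoc, one_mul]
      _ = -1 := by rw [h]; simp [mem_inv_mul hP]
  have hdet := TT_det hC'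
  have h2 : lift11 α * B' = - C'.adjugate := by
    calc lift11 α * B' = lift11 α * B' * (C' * C'.adjugate) := by
          rw [Matrix.mul_adjugate, hdet]; simp
      _ = (lift11 α * B' * C') * C'.adjugate := by simp only [mul_assoc]
      _ = _ := by rw [h']; simp
  obtain ⟨p, hp, hp0, -⟩ := TT_entry hB'
  obtain ⟨r, hr, -, hr1⟩ := TT_entry hC'
  have h00 := congrFun (congrFun h2 0) 0
  rw [lift_eq, Matrix.adjugate_fin_two] at h00
  simp only [Matrix.mul_apply, Fin.sum_univ_two, hp0, hr1, Matrix.neg_apply] at h00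
  simp [-Complex.ofReal_cos, -Complex.ofReal_sin] at h00
  have hre := congrArg Complex.re h00
  have him := congrArg Complex.im h00
  simp [-Complex.ofReal_cos, -Complex.ofReal_sin] at hre him
  obtain ⟨a, rfl⟩ : ∃ a, α = 2 * a := ⟨α/2, by ring⟩
  obtain ⟨b, rfl⟩ : ∃ a, β = 2 * a := ⟨β/2, by ring⟩
  obtain ⟨c, rfl⟩ : ∃ a, γ = 2 * a := ⟨γ/2, by ring⟩
  simp only [mul_div_cancel_left₀ _ (two_ne_zero : (2:ℝ) ≠ 0)] at hre him
  have sa : 0 < sin a := sin_pos_of_pos_of_lt_pi (by linarith) (by linarith)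
  have sb : 0 < sin b := sin_pos_of_pos_of_lt_pi (by linarith) (by linarith)
  have sc : 0 < sin c := sin_pos_of_pos_of_lt_pi (by linarith) (by linarith)
  have k1 : 0 ≤ cos (a+b) + cos c := by
    rw [cos_add]; nlinarith [mul_pos sa sb]
  have k2 : 0 ≤ cos (a+c) + cos b := by
    rw [cos_add]
    have : cos b + cos a * cos c = sin a * sin c * r := by
      linear_combination sin a * him + cos a * hre - cos b * sin_sq_add_cos_sq a
    nlinarith [mul_pos sa sc]
  rw [cos_add_cos] at k1 k2
  by_contra hcon
  push Not at hcon
  have hs : cos ((a+b+c)/2) < 0 := cos_neg_of_pi_div_two_lt_of_lt (by linarith) (by linarith)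
  have hs2 : cos ((a+c+b)/2) < 0 := by rw [add_right_comm]; exact hs
  have m1 : π/2 ≤ (a+b-c)/2 := by
    by_contra hh
    have := cos_pos_of_mem_Ioo (x := (a+b-c)/2) ⟨by linarith, by linarith⟩
    nlinarith
  have m2 : π/2 ≤ (a+c-b)/2 := by
    by_contra hh
    have := cos_pos_of_mem_Ioo (x := (a+c-b)/2) ⟨by linarith, by linarith⟩
    nlinarith
  linarith

lemma neg_one_suf {α β γ : ℝ} (hα : 0 < α ∧ α < 2 * π) (hβ : 0 < β ∧ β < 2 * π)
    (hγ : 0 < γ ∧ γ < 2 * π) (h : α + β + γ ≤ 2 * π) :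
    ∃ A B C : M2c, TT α A ∧ TT β B ∧ TT γ C ∧ A * B * C = -1 := by
  obtain ⟨a, ha⟩ : ∃ a, a = α / 2 := ⟨_, rfl⟩
  obtain ⟨b, hb⟩ : ∃ a, a = β / 2 := ⟨_, rfl⟩
  obtain ⟨c, hc⟩ : ∃ a, a = γ / 2 := ⟨_, rfl⟩
  have sa : 0 < sin a := sin_pos_of_pos_of_lt_pi (by linarith) (by linarith)
  have sb : 0 < sin b := sin_pos_of_pos_of_lt_pi (by linarith) (by linarith)
  have sc : 0 < sin c := sin_pos_of_pos_of_lt_pi (by linarith) (by linarith)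
  have k1 : sin a * sin b ≤ cos a * cos b + cos c := by
    have : cos (π - (a+b)) ≤ cos c :=
      cos_le_cos_of_nonneg_of_le_pi (by linarith) (by linarith) (by linarith)
    rw [cos_pi_sub, cos_add] at this; linarith
  have k2 : sin a * sin c ≤ cos a * cos c + cos b := by
    have : cos (π - (a+c)) ≤ cos b :=
      cos_le_cos_of_nonneg_of_le_pi (by linarith) (by linarith) (by linarith)
    rw [cos_pi_sub, cos_add] at this; linarith
  have sab := mul_pos sa sb
  have sac := mul_pos sa sc
  obtain ⟨p, hp⟩ : ∃ p, sin a * sin b * p = cos a * cos b + cos c :=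
    ⟨(cos a * cos b + cos c) / (sin a * sin b), by field_simp⟩
  have hp1 : 1 ≤ p := by nlinarith
  obtain ⟨r, hr⟩ : ∃ r, sin a * sin c * r = cos a * cos c + cos b :=
    ⟨(cos a * cos c + cos b) / (sin a * sin c), by field_simp⟩
  have hr1 : 1 ≤ r := by nlinarith
  obtain ⟨q, hq⟩ : ∃ q : ℝ, q^2 = p^2 - 1 := ⟨√(p^2-1), Real.sq_sqrt (by nlinarith)⟩
  have im : sin a * cos b + cos a * sin b * p = sin c * r := by
    have : sin a * (sin a * cos b + cos a * sin b * p - sin c * r) = 0 := by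
      linear_combination cos a * hp - hr + cos b * sin_sq_add_cos_sq a
    have := (mul_eq_zero.mp this).resolve_left sa.ne'
    linarith
  have hre : cos a * cos b - sin a * sin b * p = - cos c := by linarith
  obtain ⟨w, hw⟩ : ∃ w : ℂ, sin c * w = (cos a + sin a * Complex.I) * sin b * q :=
    ⟨(cos a + sin a * Complex.I) * sin b * q / sin c, by
      have : (sin c : ℂ) ≠ 0 := by exact_mod_cast sc.ne'
      field_simp⟩
  have hwc := congrArg (starRingEnd ℂ) hw
  have hwn := congrArg Complex.normSq hw
  simp only [map_mul, map_add, Complex.conj_ofReal, Complex.conj_I] at hwc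
  have hn : Complex.normSq (cos a + sin a * Complex.I) = 1 := by
    rw [Complex.normSq_add_mul_I, cos_sq_add_sin_sq]
  rw [map_mul, map_mul, map_mul, hn] at hwn
  simp only [Complex.normSq_ofReal] at hwn
  have hw1 : r^2 = 1 + Complex.normSq w := by
    have : sin c ^2 * (r^2 - 1 - Complex.normSq w) = 0 := by
      linear_combination -(sin a * cos b + cos a * sin b * p + sin c * r) * im
        - (cos a * cos b - sin a * sin b * p - cos c) * hre - hwn
        + (cos b^2 + sin b^2 * p^2) * sin_sq_add_cos_sq a + sin_sq_add_cos_sq b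
        - sin_sq_add_cos_sq c - sin b^2 * hq
    have := (mul_eq_zero.mp this).resolve_left (by positivity)
    linarith
  have hC := TT_of (a := γ) (p := r) (q := w) (by linarith) hw1
  have hB := TT_of (a := β) (p := p) (q := (q:ℂ)) (by linarith)
    (by rw [Complex.normSq_ofReal]; linarith)
  refine ⟨lift11 α, _, _, ⟨1, mem_one, by simp⟩, hB, hC, ?_⟩
  rw [lift_eq, ← ha, ← hb, ← hc]
  have hreC := congrArg Complex.ofReal hre
  have himC := congrArg Complex.ofReal im
  have h1 := csq a
  have h2 := csq b
  have h3 := csq c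
  have hI := Complex.I_sq
  have hN : sin b^2 * q^2 = sin c^2 * (r^2 - 1) := by
    rw [hw1]; linear_combination -hwn
  have hNC := congrArg Complex.ofReal hN
  rw [Complex.conj_ofReal]
  push_cast [-Complex.ofReal_cos, -Complex.ofReal_sin] at hreC himC hNC
  generalize (starRingEnd ℂ) w = w' at *
  generalize (cos a : ℂ) = ca, (cos b : ℂ) = cb, (cos c : ℂ) = cc, (sin a : ℂ) = sa,
    (sin b : ℂ) = sb, (sin c : ℂ) = sc, (p : ℂ) = p, (q : ℂ) = q, (r : ℂ) = r at *
  have hE : (ca + sa * Complex.I) * (cb + sb * p * Complex.I) = -(cc - sc * r * Complex.I) := by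
    linear_combination hreC + Complex.I * himC + sa * sb * p * hI
  have hE' : (ca - sa * Complex.I) * (cb - sb * p * Complex.I) = -(cc + sc * r * Complex.I) := by
    linear_combination hreC - Complex.I * himC + sa * sb * p * hI
  have hEE : (ca + sa * Complex.I) * (ca - sa * Complex.I) = 1 := by
    linear_combination h1 - sa^2 * hI
  ext i j
  fin_cases i <;> fin_cases j <;>
    simp [Matrix.mul_apply, Fin.sum_univ_two]
  · linear_combination (cc + sc * r * Complex.I) * hE
      - (ca + sa * Complex.I) * sb * q * Complex.I^2 * hwc
      - sb^2 * q^2 * Complex.I^2 * hEE - Complex.I^2 * hNC + sc^2 * hI - h3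
  · linear_combination sc * w * Complex.I * hE - (cc - sc * r * Complex.I) * Complex.I * hw
  · linear_combination - sc * w' * Complex.I * hE' + (cc + sc * r * Complex.I) * Complex.I * hwc
  · linear_combination (cc - sc * r * Complex.I) * hE'
      - (ca - sa * Complex.I) * sb * q * Complex.I^2 * hw
      - sb^2 * q^2 * Complex.I^2 * hEE - Complex.I^2 * hNC + sc^2 * hI - h3

lemma TT_neg_inv {a : ℝ} {X : M2c} (h : TT a X) : TT (2 * π - a) (-X⁻¹) := by
  obtain ⟨P, hP, rfl⟩ := h
  refine ⟨P, hP, ?_⟩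
  have hl : (lift11 a)⁻¹ = - lift11 (2 * π - a) := by
    apply Matrix.inv_eq_left_inv
    have e : (2 * π - a)/2 = π - a/2 := by ring
    have h := csq (a/2)
    have hI := Complex.I_sq
    rw [lift_eq, lift_eq, e, cos_pi_sub, sin_pi_sub]
    ext i j
    fin_cases i <;> fin_cases j <;>
      simp [Matrix.mul_apply, -Complex.ofReal_cos, -Complex.ofReal_sin]
    · linear_combination h - (sin (a/2) : ℂ)^2 * hI
    · linear_combination h - (sin (a/2) : ℂ)^2 * hI
  rw [Matrix.mul_inv_rev, Matrix.mul_inv_rev, hl, Matrix.nonsing_inv_nonsing_inv]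
  · simp [mul_assoc]
  · exact Matrix.isUnit_det_of_left_inverse (mem_inv_mul hP)

lemma neg_one_iff {α β γ : ℝ} (hα : 0 < α ∧ α < 2 * π) (hβ : 0 < β ∧ β < 2 * π)
    (hγ : 0 < γ ∧ γ < 2 * π) :
    (∃ A B C : M2c, TT α A ∧ TT β B ∧ TT γ C ∧ A * B * C = -1) ↔ α + β + γ ≤ 2 * π := by
  constructor
  · rintro ⟨A, B, C, hA, hB, hC, h⟩
    exact neg_one_nec hα hβ hγ hA hB hC h
  · exact neg_one_suf hα hβ hγ

lemma flip_prod {A B C : M2c} {e : M2c} (he : e * e = 1) (h : A * B * C = e) :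
    (-C⁻¹) * (-B⁻¹) * (-A⁻¹) = -e := by
  have : (A * B * C)⁻¹ = e := by rw [h]; exact Matrix.inv_eq_left_inv he
  rw [← this, Matrix.mul_inv_rev, Matrix.mul_inv_rev]
  simp [mul_assoc]

lemma one_iff {α β γ : ℝ} (hα : 0 < α ∧ α < 2 * π) (hβ : 0 < β ∧ β < 2 * π)
    (hγ : 0 < γ ∧ γ < 2 * π) :
    (∃ A B C : M2c, TT α A ∧ TT β B ∧ TT γ C ∧ A * B * C = 1) ↔ 4 * π ≤ α + β + γ := by
  have key := neg_one_iff (α := 2 * π - γ) (β := 2 * π - β) (γ := 2 * π - α)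
    ⟨by linarith, by linarith⟩ ⟨by linarith, by linarith⟩ ⟨by linarith, by linarith⟩
  constructor
  · rintro ⟨A, B, C, hA, hB, hC, h⟩
    have := key.1 ⟨_, _, _, TT_neg_inv hC, TT_neg_inv hB, TT_neg_inv hA,
      flip_prod (one_mul 1) h⟩
    linarith
  · intro h
    obtain ⟨A, B, C, hA, hB, hC, h⟩ := key.2 (by linarith)
    have hA := TT_neg_inv hA
    have hB := TT_neg_inv hB
    have hC := TT_neg_inv hC
    rw [sub_sub_cancel] at hA hB hC
    exact ⟨_, _, _, hC, hB, hA, by rw [flip_prod (by simp) h, neg_neg]⟩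

lemma diag_eq (a : ℝ) : Matrix.diagonal ![Complex.exp (a * Complex.I), 1] =
    Complex.exp ((a/2) * Complex.I) • lift11 a := by
  have h1 : Complex.exp ((a / 2) * Complex.I) * Complex.exp ((a / 2) * Complex.I)
      = Complex.exp (a * Complex.I) := by rw [← Complex.exp_add]; ring_nf
  have h2 : Complex.exp ((a / 2) * Complex.I) * Complex.exp ((-a / 2) * Complex.I) = 1 := by
    rw [← Complex.exp_add, ← Complex.exp_zero]; ring_nf
  ext i j; fin_cases i <;> fin_cases j <;> simp [lift11, h1, h2]

lemma ell_iff (a : ℝ) (X : M2c) : ellType11 X a ↔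
    ∃ Y, TT a Y ∧ X = Complex.exp ((a/2) * Complex.I) • Y := by
  constructor
  · rintro ⟨P, hP, h⟩
    refine ⟨_, ⟨P, hP, rfl⟩, ?_⟩
    rw [h, diag_eq]; simp
  · rintro ⟨_, ⟨P, hP, rfl⟩, h⟩
    refine ⟨P, hP, ?_⟩
    rw [h, diag_eq]; simp

lemma smul_mem (a : ℝ) {Y : M2c} (h : memU11 Y) :
    memU11 (Complex.exp ((a/2) * Complex.I) • Y) := by
  have h2 : (starRingEnd ℂ) (Complex.exp ((a / 2) * Complex.I)) *
      Complex.exp ((a / 2) * Complex.I) = 1 := by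
    rw [← Complex.exp_conj, ← Complex.exp_add, ← Complex.exp_zero]
    have h2 : (starRingEnd ℂ) 2 = 2 := Complex.conj_ofNat 2
    congr 1; simp [h2]
  unfold memU11 at *
  rw [conjTranspose_smul, Matrix.smul_mul, Matrix.smul_mul, Matrix.mul_smul, h, smul_smul]
  erw [h2]
  rw [one_smul]

lemma proj_iff {α β γ : ℝ} (hα : 0 < α ∧ α < 2 * π) (hβ : 0 < β ∧ β < 2 * π)
    (hγ : 0 < γ ∧ γ < 2 * π) :
    (∃ A B C : M2c, memU11 A ∧ memU11 B ∧ memU11 C ∧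
        ellType11 A α ∧ ellType11 B β ∧ ellType11 C γ ∧
        ∃ lam : ℂ, A * B * C = lam • (1 : M2c)) ↔
      (α + β + γ ≤ 2 * π ∨ 4 * π ≤ α + β + γ) := by
  rw [← neg_one_iff hα hβ hγ, ← one_iff hα hβ hγ]
  have hsm : ∀ A B C : M2c, ∀ x y z : ℂ, (x • A) * (y • B) * (z • C) = (x*y*z) • (A * B * C) := by
    intro A B C x y z
    simp only [Matrix.smul_mul, Matrix.mul_smul, smul_smul]
    congr 1; ring
  constructor
  · rintro ⟨A, B, C, -, -, -, hA0, hB0, hC0, lam, h⟩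
    obtain ⟨A, hA, rfl⟩ := (ell_iff _ _).1 hA0
    obtain ⟨B, hB, rfl⟩ := (ell_iff _ _).1 hB0
    obtain ⟨C, hC, rfl⟩ := (ell_iff _ _).1 hC0
    rw [hsm] at h
    have hx0 : Complex.exp ((α/2) * Complex.I) * Complex.exp ((β/2) * Complex.I)
      * Complex.exp ((γ/2) * Complex.I) ≠ 0 :=
      mul_ne_zero (mul_ne_zero (Complex.exp_ne_zero _) (Complex.exp_ne_zero _))
        (Complex.exp_ne_zero _)
    generalize Complex.exp ((α/2) * Complex.I) * Complex.exp ((β/2) * Complex.I)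
      * Complex.exp ((γ/2) * Complex.I) = x at h hx0
    have h2 : A * B * C = (x⁻¹ * lam) • (1 : M2c) := by
      rw [← smul_smul, ← h, smul_smul, inv_mul_cancel₀ hx0, one_smul]
    have hd := congrArg Matrix.det h2
    rw [det_mul, det_mul, TT_det hA, TT_det hB, TT_det hC, det_smul] at hd
    simp only [det_one, mul_one, Fintype.card_fin] at hd
    have hd2 : (x⁻¹ * lam) ^ 2 = 1 := hd.symm
    rcases sq_eq_one_iff.1 hd2 with h3 | h3
    · right; exact ⟨A, B, C, hA, hB, hC, by rw [h2, h3, one_smul]⟩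
    · left; exact ⟨A, B, C, hA, hB, hC, by rw [h2, h3, neg_one_smul]⟩
  · have main : ∀ A B C : M2c, TT α A → TT β B → TT γ C → ∀ e : ℂ, A * B * C = e • 1 →
      (∃ A B C : M2c, memU11 A ∧ memU11 B ∧ memU11 C ∧
        ellType11 A α ∧ ellType11 B β ∧ ellType11 C γ ∧
        ∃ lam : ℂ, A * B * C = lam • (1 : M2c)) := by
      intro A B C hA hB hC e he
      refine ⟨_, _, _, smul_mem α (TT_mem hA), smul_mem β (TT_mem hB), smul_mem γ (TT_mem hC),
        (ell_iff _ _).2 ⟨A, hA, rfl⟩, (ell_iff _ _).2 ⟨B, hB, rfl⟩, (ell_iff _ _).2 ⟨C, hC, rfl⟩,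
        ⟨_, by rw [hsm, he, smul_smul]⟩⟩
    rintro (⟨A, B, C, hA, hB, hC, h⟩ | ⟨A, B, C, hA, hB, hC, h⟩)
    · exact main A B C hA hB hC (-1) (by rw [h, neg_one_smul])
    · exact main A B C hA hB hC 1 (by rw [h, one_smul])

/-- Multiplicative Horn problem in PU(1,1). -/
theorem horn_PU11 (α β γ : ℝ)
    (hα : 0 < α ∧ α < 2 * π) (hβ : 0 < β ∧ β < 2 * π) (hγ : 0 < γ ∧ γ < 2 * π) :
    -- (1) projective version
    ((∃ A B C : M2c, memU11 A ∧ memU11 B ∧ memU11 C ∧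
        ellType11 A α ∧ ellType11 B β ∧ ellType11 C γ ∧
        ∃ lam : ℂ, A * B * C = lam • (1 : M2c)) ↔
      (α + β + γ ≤ 2 * π ∨ 4 * π ≤ α + β + γ)) ∧
    -- (2a) lifts multiplying to −I₂
    ((∃ A B C : M2c, memU11 A ∧ A.det = 1 ∧ memU11 B ∧ B.det = 1 ∧ memU11 C ∧ C.det = 1 ∧
        (∃ P : M2c, memU11 P ∧ A = P * lift11 α * P⁻¹) ∧
        (∃ P : M2c, memU11 P ∧ B = P * lift11 β * P⁻¹) ∧
        (∃ P : M2c, memU11 P ∧ C = P * lift11 γ * P⁻¹) ∧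
        A * B * C = -(1 : M2c)) ↔
      α + β + γ ≤ 2 * π) ∧
    -- (2b) lifts multiplying to I₂
    ((∃ A B C : M2c, memU11 A ∧ A.det = 1 ∧ memU11 B ∧ B.det = 1 ∧ memU11 C ∧ C.det = 1 ∧
        (∃ P : M2c, memU11 P ∧ A = P * lift11 α * P⁻¹) ∧
        (∃ P : M2c, memU11 P ∧ B = P * lift11 β * P⁻¹) ∧
        (∃ P : M2c, memU11 P ∧ C = P * lift11 γ * P⁻¹) ∧
        A * B * C = (1 : M2c)) ↔
      4 * π ≤ α + β + γ) := by
  refine ⟨proj_iff hα hβ hγ, ?_, ?_⟩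
  · rw [← neg_one_iff hα hβ hγ]
    constructor
    · rintro ⟨A, B, C, -, -, -, -, -, -, hA, hB, hC, h⟩
      exact ⟨A, B, C, hA, hB, hC, h⟩
    · rintro ⟨A, B, C, hA, hB, hC, h⟩
      exact ⟨A, B, C, TT_mem hA, TT_det hA, TT_mem hB, TT_det hB, TT_mem hC, TT_det hC,
        hA, hB, hC, h⟩
  · rw [← one_iff hα hβ hγ]
    constructor
    · rintro ⟨A, B, C, -, -, -, -, -, -, hA, hB, hC, h⟩
      exact ⟨A, B, C, hA, hB, hC, h⟩
    · rintro ⟨A, B, C, hA, hB, hC, h⟩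
      exact ⟨A, B, C, TT_mem hA, TT_det hA, TT_mem hB, TT_det hB, TT_mem hC, TT_det hC,
        hA, hB, hC, h⟩
end
end

section
/- Spherical reducible walls in PU(2,1): The set of τ ∈ (𝒯°)³ for which there exist A, B, C ∈ U(2,1) of elliptic types (α₁,α₂), (β₁,β₂), (γ₁,γ₂) respectively, with A·B·C = λ·I₃ for some λ ∈ ℂ, together with a common eigenvector v ∈ ℂ³∖{0} of A, B and C satisfying vᴴ·J·v < 0, is exactly (Σ₄π ∪ Σ₆π ∪ Σ₈π) ∩ (𝒯°)³. -/
open Real Matrix Set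

noncomputable section

abbrev Pt : Type := ℝ × ℝ
abbrev Tri : Type := Pt × Pt × Pt

/-- Membership in `𝒯 = {(a₁,a₂) ∈ [0,2π)² : a₁ ≥ a₂}`. -/
def memT (p : Pt) : Prop :=
  0 ≤ p.1 ∧ p.1 < 2 * π ∧ 0 ≤ p.2 ∧ p.2 < 2 * π ∧ p.2 ≤ p.1

def memT3 (τ : Tri) : Prop := memT τ.1 ∧ memT τ.2.1 ∧ memT τ.2.2

/-- Membership in the interior `𝒯° = {(a₁,a₂) : 0 < a₂ < a₁ < 2π}`. -/
def memTo (p : Pt) : Prop := 0 < p.2 ∧ p.2 < p.1 ∧ p.1 < 2 * π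

def memTo3 (τ : Tri) : Prop := memTo τ.1 ∧ memTo τ.2.1 ∧ memTo τ.2.2

/-- The sum `S(τ) = α₁+α₂+β₁+β₂+γ₁+γ₂`. -/
def Sf (τ : Tri) : ℝ := τ.1.1 + τ.1.2 + τ.2.1.1 + τ.2.1.2 + τ.2.2.1 + τ.2.2.2

/-- The coordinate of a pair: index `0` is the first coordinate (subscript 1),
index `1` the second (subscript 2). -/
def coord (p : Pt) (i : Fin 2) : ℝ := if i = 0 then p.1 else p.2

/-- `sg τ i j k = σ_{(i+1)(j+1)(k+1)}(τ) = α_i + β_j + γ_k` (indices in `Fin 2`,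
index `0` ↔ subscript 1, index `1` ↔ subscript 2). -/
def sg (τ : Tri) (i j k : Fin 2) : ℝ := coord τ.1 i + coord τ.2.1 j + coord τ.2.2 k

/-- `Hf τ i j k = 2 σ_{ijk}(τ) − σ_{ī j̄ k̄}(τ)`, the complementary index being `i+1` in `Fin 2`. -/
def Hf (τ : Tri) (i j k : Fin 2) : ℝ := 2 * sg τ i j k - sg τ (i + 1) (j + 1) (k + 1)

/-- The spherical reducible wall Σ₄π. -/
def Sig4 : Set Tri := {τ | memT3 τ ∧ Sf τ = 4 * π ∧ sg τ 0 0 0 ≤ 4 * π ∧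
  sg τ 0 1 1 ≤ 2 * π ∧ sg τ 1 0 1 ≤ 2 * π ∧ sg τ 1 1 0 ≤ 2 * π}

/-- The spherical reducible wall Σ₆π. -/
def Sig6 : Set Tri := {τ | memT3 τ ∧ Sf τ = 6 * π ∧ sg τ 1 1 1 ≤ 2 * π ∧
  sg τ 0 0 1 ≤ 4 * π ∧ sg τ 0 1 0 ≤ 4 * π ∧ sg τ 1 0 0 ≤ 4 * π}

/-- The spherical reducible wall Σ₈π. -/
def Sig8 : Set Tri := {τ | memT3 τ ∧ Sf τ = 8 * π ∧ sg τ 0 0 0 ≤ 6 * π ∧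
  sg τ 0 1 1 ≤ 4 * π ∧ sg τ 1 0 1 ≤ 4 * π ∧ sg τ 1 1 0 ≤ 4 * π}

abbrev M3 : Type := Matrix (Fin 3) (Fin 3) ℂ

/-- The form J = diag(1, 1, −1). -/
def J3 : M3 := Matrix.diagonal ![1, 1, -1]

/-- Membership in U(2,1). -/
def memU21 (M : M3) : Prop := Mᴴ * J3 * M = J3

/-- The diagonal matrix E(a₁,a₂) = diag(e^{ia₁}, e^{ia₂}, 1). -/
def Emat (a₁ a₂ : ℝ) : M3 :=
  Matrix.diagonal ![Complex.exp (a₁ * Complex.I), Complex.exp (a₂ * Complex.I), 1]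

/-- `M` is of elliptic type `(a₁,a₂)`: conjugate in U(2,1) to E(a₁,a₂). -/
def ellType (M : M3) (a₁ a₂ : ℝ) : Prop :=
  ∃ P : M3, memU21 P ∧ M = P * Emat a₁ a₂ * P⁻¹

lemma trig_core {A B C : ℝ} (hA : 0 < A) (hA' : A < π) (hB : 0 < B) (hB' : B < π)
    (hC : 0 < C) (hC' : C < π) :
    (cos (A + B) ≤ cos C ∧ cos C ≤ cos (A - B)) ↔
      (A + B + C ≤ 2 * π ∧ A ≤ B + C ∧ B ≤ A + C ∧ C ≤ A + B) := by
  have key : ∀ x y : ℝ, 0 ≤ x → x ≤ π → 0 ≤ y → y ≤ π → (cos x ≤ cos y ↔ y ≤ x) :=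
    fun x y h1 h2 h3 h4 => Real.strictAntiOn_cos.le_iff_ge ⟨h1, h2⟩ ⟨h3, h4⟩
  have h1 : cos (A - B) = cos |A - B| := (Real.cos_abs _).symm
  have habs : |A - B| ≤ π := by rw [abs_le]; constructor <;> linarith
  rw [h1, key C |A - B| hC.le hC'.le (abs_nonneg _) habs, abs_le]
  rcases le_total (A + B) π with h | h
  · rw [key (A + B) C (by linarith) h hC.le hC'.le]
    constructor
    · rintro ⟨h1, h2, h3⟩; refine ⟨?_, ?_, ?_, ?_⟩ <;> linarith
    · rintro ⟨h1, h2, h3, h4⟩; refine ⟨?_, ?_, ?_⟩ <;> linarith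
  · have h2 : cos (A + B) = cos (2 * π - (A + B)) := (Real.cos_two_pi_sub _).symm
    rw [h2, key (2 * π - (A + B)) C (by linarith) (by linarith) hC.le hC'.le]
    constructor
    · rintro ⟨h1, h2, h3⟩; refine ⟨?_, ?_, ?_, ?_⟩ <;> linarith
    · rintro ⟨h1, h2, h3, h4⟩; refine ⟨?_, ?_, ?_⟩ <;> linarith

lemma segment_iff {x y z : ℝ} (h : x ≤ y) :
    (∃ p : ℝ, 0 ≤ p ∧ p ≤ 1 ∧ p * x + (1 - p) * y = z) ↔ (x ≤ z ∧ z ≤ y) := by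
  constructor
  · rintro ⟨p, h0, h1, rfl⟩
    constructor <;> nlinarith
  · rintro ⟨h1, h2⟩
    rcases eq_or_lt_of_le h with h | h
    · exact ⟨0, le_rfl, zero_le_one, by linarith⟩
    · have h3 : 0 < y - x := by linarith
      refine ⟨(y - z) / (y - x), div_nonneg (by linarith) h3.le,
        (div_le_one h3).2 (by linarith), ?_⟩
      field_simp
      ring

lemma cos_order {A B : ℝ} (hA : 0 < A) (hA' : A < π) (hB : 0 < B) (hB' : B < π) :
    cos (A + B) ≤ cos (A - B) := by
  rw [Real.cos_add, Real.cos_sub]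
  have := mul_pos (Real.sin_pos_of_pos_of_lt_pi hA hA') (Real.sin_pos_of_pos_of_lt_pi hB hB')
  linarith

/-- The trace equation. -/
def trEq (p α₁ α₂ β₁ β₂ γ₁ γ₂ : ℝ) : Prop :=
  (p : ℂ) * (Complex.exp ((α₁ : ℂ) * Complex.I) * Complex.exp ((β₁ : ℂ) * Complex.I)
      + Complex.exp ((α₂ : ℂ) * Complex.I) * Complex.exp ((β₂ : ℂ) * Complex.I))
    + (1 - (p : ℂ)) * (Complex.exp ((α₁ : ℂ) * Complex.I) * Complex.exp ((β₂ : ℂ) * Complex.I)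
      + Complex.exp ((α₂ : ℂ) * Complex.I) * Complex.exp ((β₁ : ℂ) * Complex.I))
  = Complex.exp (((-γ₁ : ℝ) : ℂ) * Complex.I) + Complex.exp (((-γ₂ : ℝ) : ℂ) * Complex.I)

lemma exp_pair (x y : ℝ) :
    Complex.exp ((x : ℂ) * Complex.I) + Complex.exp ((y : ℂ) * Complex.I)
      = Complex.exp ((((x + y) / 2 : ℝ) : ℂ) * Complex.I) * ((2 * cos ((x - y) / 2) : ℝ) : ℂ) := by
  push_cast
  rw [Complex.two_cos, mul_add, ← Complex.exp_add, ← Complex.exp_add]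
  congr 2 <;> ring

lemma trEq_iff (p α₁ α₂ β₁ β₂ γ₁ γ₂ ε : ℝ)
    (hε : Complex.exp ((((α₁ + α₂ + β₁ + β₂ + γ₁ + γ₂) / 2 : ℝ) : ℂ) * Complex.I) = (ε : ℂ))
    (hε2 : ε * ε = 1) :
    trEq p α₁ α₂ β₁ β₂ γ₁ γ₂ ↔
      p * cos ((α₁ - α₂) / 2 + (β₁ - β₂) / 2) + (1 - p) * cos ((α₁ - α₂) / 2 - (β₁ - β₂) / 2)
        = ε * cos ((γ₁ - γ₂) / 2) := by
  unfold trEq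
  have e : ∀ x y : ℝ, Complex.exp ((x : ℂ) * Complex.I) * Complex.exp ((y : ℂ) * Complex.I)
      = Complex.exp (((x + y : ℝ) : ℂ) * Complex.I) := by
    intro x y; rw [← Complex.exp_add]; push_cast; congr 1; ring
  rw [e, e, e, e, exp_pair, exp_pair, exp_pair]
  set K := Complex.exp ((((-γ₁ + -γ₂) / 2 : ℝ) : ℂ) * Complex.I) with hK
  have hK0 : K ≠ 0 := Complex.exp_ne_zero _
  have h1 : Complex.exp ((((α₁ + β₁ + (α₂ + β₂)) / 2 : ℝ) : ℂ) * Complex.I) = (ε : ℂ) * K := by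
    rw [← hε, hK, e]; congr 3; ring
  have h2 : Complex.exp ((((α₁ + β₂ + (α₂ + β₁)) / 2 : ℝ) : ℂ) * Complex.I) = (ε : ℂ) * K := by
    rw [← hε, hK, e]; congr 3; ring
  rw [h1, h2]
  have c1 : (α₁ + β₁ - (α₂ + β₂)) / 2 = (α₁ - α₂) / 2 + (β₁ - β₂) / 2 := by ring
  have c2 : (α₁ + β₂ - (α₂ + β₁)) / 2 = (α₁ - α₂) / 2 - (β₁ - β₂) / 2 := by ring
  have c3 : cos ((-γ₁ - -γ₂) / 2) = cos ((γ₁ - γ₂) / 2) := by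
    rw [← Real.cos_neg]; congr 1; ring
  rw [c1, c2, c3]
  set X := cos ((α₁ - α₂) / 2 + (β₁ - β₂) / 2)
  set Y := cos ((α₁ - α₂) / 2 - (β₁ - β₂) / 2)
  set Z := cos ((γ₁ - γ₂) / 2)
  constructor
  · intro h
    have h' : K * ((2 * (ε * (p * X + (1 - p) * Y)) : ℝ) : ℂ) = K * ((2 * Z : ℝ) : ℂ) := by
      rw [← h]; push_cast; ring
    have h3 := mul_left_cancel₀ hK0 h'
    have h4 : 2 * (ε * (p * X + (1 - p) * Y)) = 2 * Z := by exact_mod_cast h3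
    linear_combination ε / 2 * h4 - (p * X + (1 - p) * Y) * hε2
  · intro h
    have h3 : ((ε * (p * X + (1 - p) * Y) : ℝ) : ℂ) = (Z : ℂ) := by
      rw [h]; congr 1; linear_combination Z * hε2
    push_cast at h3 ⊢
    linear_combination 2 * K * h3

lemma angle_main {α₁ α₂ β₁ β₂ γ₁ γ₂ : ℝ} (hα : 0 < α₂) (hα1 : α₂ < α₁) (hα2 : α₁ < 2 * π)
    (hβ : 0 < β₂) (hβ1 : β₂ < β₁) (hβ2 : β₁ < 2 * π)
    (hγ : 0 < γ₂) (hγ1 : γ₂ < γ₁) (hγ2 : γ₁ < 2 * π) :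
    ((∃ n : ℤ, α₁ + α₂ + β₁ + β₂ + γ₁ + γ₂ = n * (2 * π)) ∧
      ∃ p : ℝ, 0 ≤ p ∧ p ≤ 1 ∧ trEq p α₁ α₂ β₁ β₂ γ₁ γ₂) ↔
    ((α₁ + α₂ + β₁ + β₂ + γ₁ + γ₂ = 4 * π ∧ α₁ + β₁ + γ₁ ≤ 4 * π ∧ α₁ + β₂ + γ₂ ≤ 2 * π
        ∧ α₂ + β₁ + γ₂ ≤ 2 * π ∧ α₂ + β₂ + γ₁ ≤ 2 * π) ∨
     (α₁ + α₂ + β₁ + β₂ + γ₁ + γ₂ = 6 * π ∧ α₂ + β₂ + γ₂ ≤ 2 * π ∧ α₁ + β₁ + γ₂ ≤ 4 * π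
        ∧ α₁ + β₂ + γ₁ ≤ 4 * π ∧ α₂ + β₁ + γ₁ ≤ 4 * π) ∨
     (α₁ + α₂ + β₁ + β₂ + γ₁ + γ₂ = 8 * π ∧ α₁ + β₁ + γ₁ ≤ 6 * π ∧ α₁ + β₂ + γ₂ ≤ 4 * π
        ∧ α₂ + β₁ + γ₂ ≤ 4 * π ∧ α₂ + β₂ + γ₁ ≤ 4 * π)) := by
  have hA : 0 < (α₁ - α₂) / 2 := by linarith
  have hA' : (α₁ - α₂) / 2 < π := by linarith
  have hB : 0 < (β₁ - β₂) / 2 := by linarith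
  have hB' : (β₁ - β₂) / 2 < π := by linarith
  have hC : 0 < (γ₁ - γ₂) / 2 := by linarith
  have hC' : (γ₁ - γ₂) / 2 < π := by linarith
  have ev : ∀ m : ℤ, α₁ + α₂ + β₁ + β₂ + γ₁ + γ₂ = m * (4 * π) →
      ((∃ p : ℝ, 0 ≤ p ∧ p ≤ 1 ∧ trEq p α₁ α₂ β₁ β₂ γ₁ γ₂) ↔
       ((α₁ - α₂) / 2 + (β₁ - β₂) / 2 + (γ₁ - γ₂) / 2 ≤ 2 * π ∧ (α₁ - α₂) / 2 ≤ (β₁ - β₂) / 2 + (γ₁ - γ₂) / 2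
        ∧ (β₁ - β₂) / 2 ≤ (α₁ - α₂) / 2 + (γ₁ - γ₂) / 2 ∧ (γ₁ - γ₂) / 2 ≤ (α₁ - α₂) / 2 + (β₁ - β₂) / 2)) := by
    intro m hm
    have hε : Complex.exp ((((α₁ + α₂ + β₁ + β₂ + γ₁ + γ₂) / 2 : ℝ) : ℂ) * Complex.I)
        = ((1 : ℝ) : ℂ) := by
      rw [hm, Complex.ofReal_one, Complex.exp_eq_one_iff]
      exact ⟨m, by push_cast; ring⟩
    simp only [trEq_iff _ _ _ _ _ _ _ _ hε (by norm_num), one_mul]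
    rw [segment_iff (cos_order hA hA' hB hB')]
    exact trig_core hA hA' hB hB' hC hC'
  have od : ∀ m : ℤ, α₁ + α₂ + β₁ + β₂ + γ₁ + γ₂ = m * (4 * π) + 2 * π →
      ((∃ p : ℝ, 0 ≤ p ∧ p ≤ 1 ∧ trEq p α₁ α₂ β₁ β₂ γ₁ γ₂) ↔
       ((α₁ - α₂) / 2 + (β₁ - β₂) / 2 + (π - (γ₁ - γ₂) / 2) ≤ 2 * π ∧ (α₁ - α₂) / 2 ≤ (β₁ - β₂) / 2 + (π - (γ₁ - γ₂) / 2)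
        ∧ (β₁ - β₂) / 2 ≤ (α₁ - α₂) / 2 + (π - (γ₁ - γ₂) / 2) ∧ (π - (γ₁ - γ₂) / 2) ≤ (α₁ - α₂) / 2 + (β₁ - β₂) / 2)) := by
    intro m hm
    have hε : Complex.exp ((((α₁ + α₂ + β₁ + β₂ + γ₁ + γ₂) / 2 : ℝ) : ℂ) * Complex.I)
        = ((-1 : ℝ) : ℂ) := by
      rw [hm]
      have : (((m * (4 * π) + 2 * π) / 2 : ℝ) : ℂ) * Complex.I
        = m * (2 * π * Complex.I) + π * Complex.I := by push_cast; ring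
      rw [this, Complex.exp_add, Complex.exp_pi_mul_I,
        (Complex.exp_eq_one_iff).2 ⟨m, rfl⟩]
      simp
    simp only [trEq_iff _ _ _ _ _ _ _ _ hε (by norm_num), neg_one_mul, ← Real.cos_pi_sub]
    rw [segment_iff (cos_order hA hA' hB hB')]
    exact trig_core hA hA' hB hB' (C := π - (γ₁ - γ₂) / 2) (by linarith) (by linarith)
  have hπ := Real.pi_pos
  constructor
  · rintro ⟨⟨n, hn⟩, hp⟩
    have n0 : 0 < n := by
      have : (0 : ℝ) < n := by
        by_contra hh
        have : (n : ℝ) * (2 * π) ≤ 0 := mul_nonpos_of_nonpos_of_nonneg (by linarith) (by linarith)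
        linarith
      exact_mod_cast this
    have n6 : n < 6 := by
      have : (n : ℝ) < 6 := by
        by_contra hh
        have : (6 : ℝ) * (2 * π) ≤ n * (2 * π) :=
          mul_le_mul_of_nonneg_right (by linarith) (by linarith)
        linarith
      exact_mod_cast this
    interval_cases n
    · have := (od 0 (by push_cast at hn ⊢; linarith)).1 hp
      push_cast at hn
      linarith [this.1, this.2.1, this.2.2.1, this.2.2.2]
    · have := (ev 1 (by push_cast at hn ⊢; linarith)).1 hp
      obtain ⟨t1, t2, t3, t4⟩ := this
      push_cast at hn
      left; refine ⟨?_, ?_, ?_, ?_, ?_⟩ <;> linarith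
    · have := (od 1 (by push_cast at hn ⊢; linarith)).1 hp
      obtain ⟨t1, t2, t3, t4⟩ := this
      push_cast at hn
      right; left; refine ⟨?_, ?_, ?_, ?_, ?_⟩ <;> linarith
    · have := (ev 2 (by push_cast at hn ⊢; linarith)).1 hp
      obtain ⟨t1, t2, t3, t4⟩ := this
      push_cast at hn
      right; right; refine ⟨?_, ?_, ?_, ?_, ?_⟩ <;> linarith
    · have := (od 2 (by push_cast at hn ⊢; linarith)).1 hp
      push_cast at hn
      linarith [this.1, this.2.1, this.2.2.1, this.2.2.2]
  · rintro (⟨hn, t1, t2, t3, t4⟩ | ⟨hn, t1, t2, t3, t4⟩ | ⟨hn, t1, t2, t3, t4⟩)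
    · refine ⟨⟨2, by push_cast; linarith⟩, (ev 1 (by push_cast; linarith)).2 ⟨?_, ?_, ?_, ?_⟩⟩ <;>
        linarith
    · refine ⟨⟨3, by push_cast; linarith⟩, (od 1 (by push_cast; linarith)).2 ⟨?_, ?_, ?_, ?_⟩⟩ <;>
        linarith
    · refine ⟨⟨4, by push_cast; linarith⟩, (ev 2 (by push_cast; linarith)).2 ⟨?_, ?_, ?_, ?_⟩⟩ <;>
        linarith

lemma J3_sq : J3 * J3 = 1 := by
  ext i j; fin_cases i <;> fin_cases j <;> simp [J3]

lemma J3_herm : J3ᴴ = J3 := by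
  ext i j; fin_cases i <;> fin_cases j <;> simp [J3]

lemma u_left {P : M3} (h : memU21 P) : (J3 * Pᴴ * J3) * P = 1 := by
  have h' : Pᴴ * J3 * P = J3 := h
  calc (J3 * Pᴴ * J3) * P = J3 * (Pᴴ * J3 * P) := by simp only [Matrix.mul_assoc]
    _ = 1 := by rw [h', J3_sq]

lemma u_inv {P : M3} (h : memU21 P) : P⁻¹ = J3 * Pᴴ * J3 := Matrix.inv_eq_left_inv (u_left h)

lemma u_inv_mul {P : M3} (h : memU21 P) : P⁻¹ * P = 1 := by rw [u_inv h, u_left h]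

lemma u_mul_inv {P : M3} (h : memU21 P) : P * P⁻¹ = 1 := mul_eq_one_comm.1 (u_inv_mul h)

lemma u_right {P : M3} (h : memU21 P) : P * J3 * Pᴴ = J3 := by
  have h1 := u_mul_inv h
  rw [u_inv h] at h1
  calc P * J3 * Pᴴ = P * J3 * Pᴴ * (J3 * J3) := by rw [J3_sq, Matrix.mul_one]
    _ = (P * (J3 * Pᴴ * J3)) * J3 := by simp only [Matrix.mul_assoc]
    _ = J3 := by rw [h1, Matrix.one_mul]

lemma u_mul {P Q : M3} (h : memU21 P) (k : memU21 Q) : memU21 (P * Q) := by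
  have h' : Pᴴ * J3 * P = J3 := h
  have k' : Qᴴ * J3 * Q = J3 := k
  unfold memU21
  calc (P * Q)ᴴ * J3 * (P * Q) = Qᴴ * (Pᴴ * J3 * P) * Q := by
        rw [Matrix.conjTranspose_mul]; simp only [Matrix.mul_assoc]
    _ = J3 := by rw [h', k']

lemma u_inv_mem {P : M3} (h : memU21 P) : memU21 P⁻¹ := by
  unfold memU21
  rw [u_inv h]
  simp only [Matrix.conjTranspose_mul, J3_herm, Matrix.conjTranspose_conjTranspose]
  calc J3 * (P * J3) * J3 * (J3 * Pᴴ * J3) = J3 * (P * J3 * (J3 * J3) * Pᴴ * J3) := by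
        simp only [Matrix.mul_assoc]
    _ = J3 * (J3 * J3) := by rw [J3_sq, Matrix.mul_one, u_right h, J3_sq]
    _ = J3 := by rw [J3_sq, Matrix.mul_one]

lemma exp_conj_mul (a : ℝ) :
    (starRingEnd ℂ) (Complex.exp ((a : ℂ) * Complex.I)) * Complex.exp ((a : ℂ) * Complex.I) = 1 := by
  rw [← Complex.exp_conj, ← Complex.exp_add]
  simp

lemma exp_neg_mul (a : ℝ) :
    Complex.exp ((a : ℂ) * Complex.I) * Complex.exp (((-a : ℝ) : ℂ) * Complex.I) = 1 := by
  rw [← Complex.exp_add]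
  simp

lemma exp_conj_eq (a : ℝ) :
    (starRingEnd ℂ) (Complex.exp ((a : ℂ) * Complex.I)) = Complex.exp (((-a : ℝ) : ℂ) * Complex.I) := by
  rw [← Complex.exp_conj]
  simp

lemma exp_ne_one {a : ℝ} (h : 0 < a) (h' : a < 2 * π) : Complex.exp ((a : ℂ) * Complex.I) ≠ 1 := by
  intro hh
  obtain ⟨n, hn⟩ := Complex.exp_eq_one_iff.1 hh
  have h1 : (a : ℂ) = ((n * (2 * π) : ℝ) : ℂ) := by
    apply mul_right_cancel₀ Complex.I_ne_zero
    rw [hn]; push_cast; ring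
  have h2 : a = n * (2 * π) := by exact_mod_cast h1
  have hπ := Real.pi_pos
  have n0 : (0 : ℝ) < n := by
    by_contra hh
    have : (n : ℝ) * (2 * π) ≤ 0 := mul_nonpos_of_nonpos_of_nonneg (by linarith) (by linarith)
    linarith
  have n1 : (n : ℝ) < 1 := by
    by_contra hh
    have : (1 : ℝ) * (2 * π) ≤ n * (2 * π) :=
      mul_le_mul_of_nonneg_right (by linarith) (by linarith)
    linarith
  have n0' : 0 < n := by exact_mod_cast n0
  have n1' : n < 1 := by exact_mod_cast n1
  omega

lemma u_E (a b : ℝ) : memU21 (Emat a b) := by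
  unfold memU21
  ext i j
  fin_cases i <;> fin_cases j <;>
    simp [J3, Emat, Matrix.diagonal_conjTranspose, ← Complex.exp_conj, ← Complex.exp_add]

lemma E_mul_neg (a b : ℝ) : Emat a b * Emat (-a) (-b) = 1 := by
  ext i j
  fin_cases i <;> fin_cases j <;> simp [Emat, ← Complex.exp_add]

lemma u_conj {P : M3} (h : memU21 P) (a b : ℝ) : memU21 (P * Emat a b * P⁻¹) :=
  u_mul (u_mul h (u_E a b)) (u_inv_mem h)

lemma conj_mul_neg {P : M3} (h : memU21 P) (a b : ℝ) :
    (P * Emat a b * P⁻¹) * (P * Emat (-a) (-b) * P⁻¹) = 1 := by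
  calc (P * Emat a b * P⁻¹) * (P * Emat (-a) (-b) * P⁻¹)
      = P * (Emat a b * ((P⁻¹ * P) * Emat (-a) (-b))) * P⁻¹ := by simp only [Matrix.mul_assoc]
    _ = 1 := by rw [u_inv_mul h, Matrix.one_mul, E_mul_neg, Matrix.mul_one, u_mul_inv h]

lemma form_pres {P : M3} (h : memU21 P) (w : Fin 3 → ℂ) :
    star (P *ᵥ w) ⬝ᵥ J3 *ᵥ (P *ᵥ w) = star w ⬝ᵥ J3 *ᵥ w := by
  have h' : Pᴴ * J3 * P = J3 := h
  rw [Matrix.star_mulVec, ← Matrix.dotProduct_mulVec, Matrix.mulVec_mulVec, Matrix.mulVec_mulVec,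
    h']

lemma neg_eigvec {P : M3} (h : memU21 P) {a b : ℝ} (ha : 0 < a) (ha' : a < 2 * π) (hb : 0 < b)
    (hb' : b < 2 * π) {v : Fin 3 → ℂ} {c : ℂ} (hv : (P * Emat a b * P⁻¹) *ᵥ v = c • v)
    {r : ℝ} (hr : r < 0) (hf : star v ⬝ᵥ J3.mulVec v = (r : ℂ)) :
    c = 1 ∧ ∃ w : ℂ, w ≠ 0 ∧ v = P *ᵥ ![0, 0, w] := by
  obtain ⟨w, rfl⟩ : ∃ w, v = P *ᵥ w := ⟨P⁻¹ *ᵥ v, by simp [u_mul_inv h]⟩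
  rw [form_pres h] at hf
  have hE : Emat a b *ᵥ w = c • w := by
    have := congrArg (P⁻¹ *ᵥ ·) hv
    simp only [Matrix.mulVec_mulVec, Matrix.mulVec_smul] at this
    rw [u_inv_mul h, Matrix.one_mulVec] at this
    rw [← this]
    congr 1
    calc Emat a b = (P⁻¹ * P) * Emat a b * (P⁻¹ * P) := by rw [u_inv_mul h]; simp
      _ = _ := by simp only [Matrix.mul_assoc]
  have e0 := congrFun hE 0
  have e1 := congrFun hE 1
  have e2 := congrFun hE 2
  simp [Emat, Matrix.mulVec_diagonal] at e0 e1 e2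
  have hw2 : w 2 ≠ 0 := by
    intro h0
    have hf' := congrArg Complex.re hf
    simp [J3, dotProduct, Fin.sum_univ_three, Matrix.mulVec_diagonal, h0] at hf'
    nlinarith [mul_self_nonneg (w 0).re, mul_self_nonneg (w 0).im, mul_self_nonneg (w 1).re,
      mul_self_nonneg (w 1).im]
  have hc : c = 1 := by
    apply mul_right_cancel₀ hw2
    rw [one_mul]
    exact e2.symm
  subst hc
  have hw0 : w 0 = 0 := by
    by_contra h0
    exact exp_ne_one ha ha' (mul_right_cancel₀ h0 (by simpa [h0] using e0))
  have hw1 : w 1 = 0 := by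
    by_contra h0
    exact exp_ne_one hb hb' (mul_right_cancel₀ h0 (by simpa [h0] using e1))
  refine ⟨rfl, w 2, hw2, ?_⟩
  congr 1
  ext i; fin_cases i <;> simp [hw0, hw1]

lemma u_block_trace {Q : M3} (h : memU21 Q) {x y : ℂ} (hx : x ≠ 0)
    (hQ : Q *ᵥ ![0, 0, x] = ![0, 0, y]) (a₁ a₂ b₁ b₂ : ℝ) :
    ∃ p : ℝ, 0 ≤ p ∧ p ≤ 1 ∧ (Emat a₁ a₂ * (Q * Emat b₁ b₂ * Q⁻¹)).trace =
      (p : ℂ) * (Complex.exp ((a₁ : ℂ) * Complex.I) * Complex.exp ((b₁ : ℂ) * Complex.I)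
      + Complex.exp ((a₂ : ℂ) * Complex.I) * Complex.exp ((b₂ : ℂ) * Complex.I))
    + (1 - (p : ℂ)) * (Complex.exp ((a₁ : ℂ) * Complex.I) * Complex.exp ((b₂ : ℂ) * Complex.I)
      + Complex.exp ((a₂ : ℂ) * Complex.I) * Complex.exp ((b₁ : ℂ) * Complex.I)) + 1 := by
  have q0 := congrFun hQ 0
  have q1 := congrFun hQ 1
  simp [Matrix.mulVec, dotProduct, Fin.sum_univ_three, hx] at q0 q1
  have hl : Qᴴ * J3 * Q = J3 := h
  have hr := u_right h
  have l22 := congrFun (congrFun hl 2) 2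
  have l00 := congrFun (congrFun hl 0) 0
  have r00 := congrFun (congrFun hr 0) 0
  have r11 := congrFun (congrFun hr 1) 1
  have l20 := congrFun (congrFun hl 2) 0
  have l21 := congrFun (congrFun hl 2) 1
  simp [J3, Matrix.mul_apply, Fin.sum_univ_three, Matrix.diagonal, q0, q1] at l22 l00 r00 r11 l20 l21
  have hq : Q 2 2 ≠ 0 := by intro h0; simp [h0] at l22
  have z0 : Q 2 0 = 0 := by simpa [hq] using l20
  have z1 : Q 2 1 = 0 := by simpa [hq] using l21
  rw [z0] at l00
  simp at l00
  have n00 : (starRingEnd ℂ) (Q 0 0) * Q 0 0 = ((Complex.normSq (Q 0 0) : ℝ) : ℂ) := by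
    rw [Complex.normSq_eq_conj_mul_self]
  have hre := congrArg Complex.re r00
  simp at hre
  refine ⟨Complex.normSq (Q 0 0), Complex.normSq_nonneg _, ?_, ?_⟩
  · rw [Complex.normSq_apply]
    nlinarith [mul_self_nonneg (Q 0 1).re, mul_self_nonneg (Q 0 1).im]
  · rw [u_inv h]
    simp [J3, Emat, Matrix.trace, Matrix.mul_apply, Fin.sum_univ_three, Matrix.diagonal, q0, q1, z0, z1]
    set e1 := Complex.exp ((a₁ : ℂ) * Complex.I)
    set e2 := Complex.exp ((a₂ : ℂ) * Complex.I)
    set f1 := Complex.exp ((b₁ : ℂ) * Complex.I)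
    set f2 := Complex.exp ((b₂ : ℂ) * Complex.I)
    rw [← n00]
    linear_combination e1 * f2 * r00 + e2 * f1 * l00 + e2 * f2 * (r11 - l00) + l22

lemma det_conj {P : M3} (h : memU21 P) (a b : ℝ) :
    (P * Emat a b * P⁻¹).det =
      Complex.exp ((a : ℂ) * Complex.I) * Complex.exp ((b : ℂ) * Complex.I) := by
  have h1 : P.det * P⁻¹.det = 1 := by rw [← Matrix.det_mul, u_mul_inv h, Matrix.det_one]
  rw [Matrix.det_mul, Matrix.det_mul]
  have h2 : (Emat a b).det =
      Complex.exp ((a : ℂ) * Complex.I) * Complex.exp ((b : ℂ) * Complex.I) := by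
    simp [Emat, Matrix.det_diagonal, Fin.prod_univ_three]
  rw [h2]
  linear_combination
    Complex.exp ((a : ℂ) * Complex.I) * Complex.exp ((b : ℂ) * Complex.I) * h1

lemma forward {α₁ α₂ β₁ β₂ γ₁ γ₂ : ℝ} (hα : 0 < α₂) (hα1 : α₂ < α₁) (hα2 : α₁ < 2 * π)
    (hβ : 0 < β₂) (hβ1 : β₂ < β₁) (hβ2 : β₁ < 2 * π)
    (hγ : 0 < γ₂) (hγ1 : γ₂ < γ₁) (hγ2 : γ₁ < 2 * π) {P Q R : M3} (hP : memU21 P)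
    (hQ : memU21 Q) (hR : memU21 R) {lam a b c : ℂ} {v : Fin 3 → ℂ} {r : ℝ} (hr : r < 0)
    (hlam : (P * Emat α₁ α₂ * P⁻¹) * (Q * Emat β₁ β₂ * Q⁻¹) * (R * Emat γ₁ γ₂ * R⁻¹)
      = lam • (1 : M3)) (hv0 : v ≠ 0)
    (ha : (P * Emat α₁ α₂ * P⁻¹) *ᵥ v = a • v) (hb : (Q * Emat β₁ β₂ * Q⁻¹) *ᵥ v = b • v)
    (hc : (R * Emat γ₁ γ₂ * R⁻¹) *ᵥ v = c • v) (hf : star v ⬝ᵥ J3.mulVec v = (r : ℂ)) :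
    (∃ n : ℤ, α₁ + α₂ + β₁ + β₂ + γ₁ + γ₂ = n * (2 * π)) ∧
      ∃ p : ℝ, 0 ≤ p ∧ p ≤ 1 ∧ trEq p α₁ α₂ β₁ β₂ γ₁ γ₂ := by
  obtain ⟨rfl, x, hx, hvx⟩ := neg_eigvec hP (by linarith) (by linarith) (by linarith) (by linarith)
    ha hr hf
  obtain ⟨rfl, y, hy, hvy⟩ := neg_eigvec hQ (by linarith) (by linarith) (by linarith) (by linarith)
    hb hr hf
  obtain ⟨rfl, z, hz, hvz⟩ := neg_eigvec hR (by linarith) (by linarith) (by linarith) (by linarith)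
    hc hr hf
  have hl1 : lam = 1 := by
    have h1 := congrArg (· *ᵥ v) hlam
    beta_reduce at h1
    rw [← Matrix.mulVec_mulVec, ← Matrix.mulVec_mulVec] at h1
    rw [hc, one_smul, hb, one_smul, ha, Matrix.smul_mulVec, Matrix.one_mulVec] at h1
    have h2 : (1 - lam) • v = 0 := by rw [sub_smul, ← h1]; simp
    rcases smul_eq_zero.1 h2 with h3 | h3
    · linear_combination -h3
    · exact absurd h3 hv0
  subst hl1
  rw [one_smul] at hlam
  constructor
  · have hd := congrArg Matrix.det hlam
    rw [Matrix.det_mul, Matrix.det_mul, det_conj hP, det_conj hQ, det_conj hR, Matrix.det_one] at hd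
    simp only [← Complex.exp_add] at hd
    obtain ⟨n, hn⟩ := Complex.exp_eq_one_iff.1 hd
    refine ⟨n, ?_⟩
    have h1 : ((α₁ + α₂ + β₁ + β₂ + γ₁ + γ₂ : ℝ) : ℂ) = ((n * (2 * π) : ℝ) : ℂ) := by
      apply mul_right_cancel₀ Complex.I_ne_zero
      push_cast
      linear_combination hn
    exact_mod_cast h1
  · have hAB : (P * Emat α₁ α₂ * P⁻¹) * (Q * Emat β₁ β₂ * Q⁻¹) = R * Emat (-γ₁) (-γ₂) * R⁻¹ := by
      calc _ = (P * Emat α₁ α₂ * P⁻¹) * (Q * Emat β₁ β₂ * Q⁻¹) *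
            ((R * Emat γ₁ γ₂ * R⁻¹) * (R * Emat (-γ₁) (-γ₂) * R⁻¹)) := by
              rw [conj_mul_neg hR, Matrix.mul_one]
        _ = ((P * Emat α₁ α₂ * P⁻¹) * (Q * Emat β₁ β₂ * Q⁻¹) *
            (R * Emat γ₁ γ₂ * R⁻¹)) * (R * Emat (-γ₁) (-γ₂) * R⁻¹) := by
              simp only [Matrix.mul_assoc]
        _ = _ := by rw [hlam, Matrix.one_mul]
    have hU : memU21 (P⁻¹ * Q) := u_mul (u_inv_mem hP) hQ
    have hUv : (P⁻¹ * Q) *ᵥ ![0, 0, y] = ![0, 0, x] := by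
      rw [← Matrix.mulVec_mulVec, ← hvy, hvx, Matrix.mulVec_mulVec, u_inv_mul hP,
        Matrix.one_mulVec]
    obtain ⟨p, hp0, hp1, htr⟩ := u_block_trace hU hy hUv α₁ α₂ β₁ β₂
    refine ⟨p, hp0, hp1, ?_⟩
    have hinv : (P⁻¹ * Q)⁻¹ = Q⁻¹ * P := by
      apply Matrix.inv_eq_left_inv
      calc Q⁻¹ * P * (P⁻¹ * Q) = Q⁻¹ * ((P * P⁻¹) * Q) := by simp only [Matrix.mul_assoc]
        _ = 1 := by rw [u_mul_inv hP, Matrix.one_mul, u_inv_mul hQ]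
    have t1 : (Emat α₁ α₂ * ((P⁻¹ * Q) * Emat β₁ β₂ * (P⁻¹ * Q)⁻¹)).trace
        = (R * Emat (-γ₁) (-γ₂) * R⁻¹).trace := by
      rw [← hAB, hinv]
      have : (P * Emat α₁ α₂ * P⁻¹) * (Q * Emat β₁ β₂ * Q⁻¹) =
        P * (Emat α₁ α₂ * (P⁻¹ * Q * Emat β₁ β₂ * Q⁻¹)) := by simp only [Matrix.mul_assoc]
      rw [this, Matrix.trace_mul_comm P]
      simp only [Matrix.mul_assoc]
    have t2 : (R * Emat (-γ₁) (-γ₂) * R⁻¹).trace = (Emat (-γ₁) (-γ₂)).trace := by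
      rw [Matrix.trace_mul_comm, ← Matrix.mul_assoc, u_inv_mul hR, Matrix.one_mul]
    rw [t2, htr] at t1
    unfold trEq
    have t3 : (Emat (-γ₁) (-γ₂)).trace = Complex.exp (((-γ₁ : ℝ) : ℂ) * Complex.I)
        + Complex.exp (((-γ₂ : ℝ) : ℂ) * Complex.I) + 1 := by
      simp [Emat, Matrix.trace, Fin.sum_univ_three]
    rw [t3] at t1
    exact add_right_cancel t1

/-- Block-diagonal `2 + 1` matrices. -/
def blk (a b c d : ℂ) : M3 := !![a, b, 0; c, d, 0; 0, 0, 1]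

lemma blk_mem {a b c d : ℂ} (h1 : (starRingEnd ℂ) a * a + (starRingEnd ℂ) c * c = 1)
    (h2 : (starRingEnd ℂ) b * b + (starRingEnd ℂ) d * d = 1)
    (h3 : (starRingEnd ℂ) a * b + (starRingEnd ℂ) c * d = 0) : memU21 (blk a b c d) := by
  have h4 := congrArg (starRingEnd ℂ) h3
  simp at h4
  have h5 : (starRingEnd ℂ) b * a + (starRingEnd ℂ) d * c = 0 := by linear_combination h4
  unfold memU21
  ext i j
  fin_cases i <;> fin_cases j <;>
    simp [J3, blk, Matrix.mul_apply, Fin.sum_univ_three, Matrix.diagonal, h1, h2, h3, h5]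

lemma E_blk (x y : ℝ) : Emat x y = blk (Complex.exp ((x : ℂ) * Complex.I)) 0 0
      (Complex.exp ((y : ℂ) * Complex.I)) := by
  ext i j; fin_cases i <;> fin_cases j <;> simp [Emat, blk]

lemma blk_mul (a b c d a' b' c' d' : ℂ) : blk a b c d * blk a' b' c' d' =
    blk (a * a' + b * c') (a * b' + b * d') (c * a' + d * c') (c * b' + d * d') := by
  ext i j; fin_cases i <;> fin_cases j <;> simp [blk, Matrix.mul_apply, Fin.sum_univ_three]

lemma blk_vec (a b c d : ℂ) : blk a b c d *ᵥ ![0, 0, 1] = ![0, 0, 1] := by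
  ext i; fin_cases i <;> simp [blk, Matrix.mulVec, dotProduct, Fin.sum_univ_three]

lemma diagonalize {a b : ℂ} {x y : ℝ}
    (hab : (starRingEnd ℂ) a * a + (starRingEnd ℂ) b * b = 1)
    (htr : a + Complex.exp ((x : ℂ) * Complex.I) * Complex.exp ((y : ℂ) * Complex.I)
        * (starRingEnd ℂ) a
      = Complex.exp ((x : ℂ) * Complex.I) + Complex.exp ((y : ℂ) * Complex.I)) :
    ∃ R : M3, memU21 R ∧
      blk a b (-(Complex.exp ((x : ℂ) * Complex.I) * Complex.exp ((y : ℂ) * Complex.I)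
          * (starRingEnd ℂ) b))
        (Complex.exp ((x : ℂ) * Complex.I) * Complex.exp ((y : ℂ) * Complex.I)
          * (starRingEnd ℂ) a) = R * Emat x y * R⁻¹ := by
  have hx := exp_conj_mul x
  have hy := exp_conj_mul y
  have hE : Emat x y = blk (Complex.exp ((x : ℂ) * Complex.I)) 0 0
      (Complex.exp ((y : ℂ) * Complex.I)) := by
    ext i j; fin_cases i <;> fin_cases j <;> simp [Emat, blk]
  suffices ∃ R : M3, memU21 R ∧
      blk a b (-(Complex.exp ((x : ℂ) * Complex.I) * Complex.exp ((y : ℂ) * Complex.I)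
          * (starRingEnd ℂ) b))
        (Complex.exp ((x : ℂ) * Complex.I) * Complex.exp ((y : ℂ) * Complex.I)
          * (starRingEnd ℂ) a) * R = R * Emat x y by
    obtain ⟨R, hR, h⟩ := this
    exact ⟨R, hR, by rw [← h, Matrix.mul_assoc, u_mul_inv hR, Matrix.mul_one]⟩
  rw [hE]
  set X := Complex.exp ((x : ℂ) * Complex.I)
  set Y := Complex.exp ((y : ℂ) * Complex.I)
  by_cases hW : b = 0 ∧ a = X
  · obtain ⟨rfl, rfl⟩ := hW
    refine ⟨blk 1 0 0 1, blk_mem (by simp) (by simp) (by simp), ?_⟩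
    have : X * Y * (starRingEnd ℂ) X = Y := by linear_combination htr
    simp [blk, this]
  · set N : ℝ := Complex.normSq b + Complex.normSq (X - a) with hN
    have hN0 : 0 < N := by
      by_contra h0
      have h1 := Complex.normSq_nonneg b
      have h2 := Complex.normSq_nonneg (X - a)
      apply hW
      constructor
      · exact Complex.normSq_eq_zero.1 (by linarith)
      · exact (sub_eq_zero.1 (Complex.normSq_eq_zero.1 (by linarith))).symm
    set s : ℝ := (√N)⁻¹ with hs
    have hsN' : s * s * N = 1 := by
      rw [hs, ← mul_inv, Real.mul_self_sqrt hN0.le, inv_mul_cancel₀ hN0.ne']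
    have hsN : (s : ℂ) * s * ((starRingEnd ℂ) b * b
        + ((starRingEnd ℂ) X - (starRingEnd ℂ) a) * (X - a)) = 1 := by
      have : (N : ℂ) = (starRingEnd ℂ) b * b
        + ((starRingEnd ℂ) X - (starRingEnd ℂ) a) * (X - a) := by
        rw [hN]; push_cast
        rw [Complex.normSq_eq_conj_mul_self, Complex.normSq_eq_conj_mul_self, map_sub]
      rw [← this]; exact_mod_cast hsN'
    refine ⟨blk (s * b) (s * -((starRingEnd ℂ) X - (starRingEnd ℂ) a)) (s * (X - a))
      (s * (starRingEnd ℂ) b), blk_mem ?_ ?_ ?_, ?_⟩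
    · simp only [map_mul, map_sub, Complex.conj_ofReal]; linear_combination hsN
    · simp only [map_mul, map_sub, map_neg, Complex.conj_ofReal, Complex.conj_conj]
      linear_combination hsN
    · simp only [map_mul, map_sub, map_neg, Complex.conj_ofReal, Complex.conj_conj]; ring
    · set a' := (starRingEnd ℂ) a
      set b' := (starRingEnd ℂ) b
      set X' := (starRingEnd ℂ) X
      have g1 : -(X * Y * b') * (s * b) + X * Y * a' * (s * (X - a)) = s * (X - a) * X := by
        linear_combination (-(s * X * Y)) * hab + s * X * htr
      have g2 : a * (s * -(X' - a')) + b * (s * b') = s * -(X' - a') * Y := by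
        linear_combination s * hab - s * X' * htr + (s * Y * a' - s) * hx
      have g3 : X * Y * b' * (s * (X' - a')) + X * Y * a' * (s * b') = s * b' * Y := by
        linear_combination s * Y * b' * hx
      ext i j
      fin_cases i <;> fin_cases j <;>
        simp [blk, Matrix.mul_apply, Fin.sum_univ_three]
      · ring
      · linear_combination g2
      · linear_combination g1
      · linear_combination g3

lemma backward {α₁ α₂ β₁ β₂ γ₁ γ₂ : ℝ}
    (hn : ∃ n : ℤ, α₁ + α₂ + β₁ + β₂ + γ₁ + γ₂ = n * (2 * π))
    (hp : ∃ p : ℝ, 0 ≤ p ∧ p ≤ 1 ∧ trEq p α₁ α₂ β₁ β₂ γ₁ γ₂) :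
    ∃ A B C : M3, memU21 A ∧ memU21 B ∧ memU21 C ∧
        ellType A α₁ α₂ ∧ ellType B β₁ β₂ ∧ ellType C γ₁ γ₂ ∧
        (∃ lam : ℂ, A * B * C = lam • (1 : M3)) ∧
        (∃ v : Fin 3 → ℂ, v ≠ 0 ∧
          (∃ a : ℂ, A.mulVec v = a • v) ∧ (∃ b : ℂ, B.mulVec v = b • v) ∧
          (∃ c : ℂ, C.mulVec v = c • v) ∧
          (∃ r : ℝ, r < 0 ∧ star v ⬝ᵥ J3.mulVec v = (r : ℂ))) := by
  obtain ⟨n, hn⟩ := hn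
  obtain ⟨p, hp0, hp1, htr⟩ := hp
  unfold trEq at htr
  set c : ℝ := √p with hc
  set s : ℝ := √(1 - p) with hs
  have hcc : (c : ℂ) * c = p := by
    have : c * c = p := Real.mul_self_sqrt hp0
    exact_mod_cast this
  have hss : (s : ℂ) * s = 1 - p := by
    have : s * s = 1 - p := Real.mul_self_sqrt (by linarith)
    exact_mod_cast this
  have hdet : Complex.exp ((α₁ : ℂ) * Complex.I) * Complex.exp ((α₂ : ℂ) * Complex.I)
      * Complex.exp ((β₁ : ℂ) * Complex.I) * Complex.exp ((β₂ : ℂ) * Complex.I)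
      = Complex.exp (((-γ₁ : ℝ) : ℂ) * Complex.I) * Complex.exp (((-γ₂ : ℝ) : ℂ) * Complex.I) := by
    simp only [← Complex.exp_add]
    rw [Complex.exp_eq_exp_iff_exists_int]
    refine ⟨n, ?_⟩
    have h1 : ((α₁ + α₂ + β₁ + β₂ + γ₁ + γ₂ : ℝ) : ℂ) = ((n * (2 * π) : ℝ) : ℂ) := by rw [hn]
    push_cast at h1 ⊢
    linear_combination Complex.I * h1
  have ea1 := exp_conj_mul α₁
  have ea2 := exp_conj_mul α₂
  have eb1 := exp_conj_mul β₁
  have eb2 := exp_conj_mul β₂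
  have hQ : memU21 (blk c (-s) s c) := by
    apply blk_mem
    · simp only [Complex.conj_ofReal]; linear_combination hcc + hss
    · simp only [Complex.conj_ofReal, map_neg]; linear_combination hcc + hss
    · simp only [Complex.conj_ofReal]; ring
  have hQi : (blk c (-s) s c)⁻¹ = blk c s (-s) c := by
    rw [u_inv hQ]
    ext i j
    fin_cases i <;> fin_cases j <;>
      simp [J3, blk, Matrix.mul_apply, Fin.sum_univ_three, Matrix.diagonal]
  have hAB : Emat α₁ α₂ * (blk c (-s) s c * Emat β₁ β₂ * (blk c (-s) s c)⁻¹) =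
      blk (Complex.exp ((α₁ : ℂ) * Complex.I) * (p * Complex.exp ((β₁ : ℂ) * Complex.I)
          + (1 - p) * Complex.exp ((β₂ : ℂ) * Complex.I)))
        (Complex.exp ((α₁ : ℂ) * Complex.I) * (c * s * (Complex.exp ((β₁ : ℂ) * Complex.I)
          - Complex.exp ((β₂ : ℂ) * Complex.I))))
        (Complex.exp ((α₂ : ℂ) * Complex.I) * (c * s * (Complex.exp ((β₁ : ℂ) * Complex.I)
          - Complex.exp ((β₂ : ℂ) * Complex.I))))
        (Complex.exp ((α₂ : ℂ) * Complex.I) * ((1 - p) * Complex.exp ((β₁ : ℂ) * Complex.I)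
          + p * Complex.exp ((β₂ : ℂ) * Complex.I))) := by
    rw [hQi, ← hcc]
    have hss' : 1 - (c : ℂ) * c = s * s := by rw [hcc, hss]
    rw [hss']
    rw [E_blk, E_blk, blk_mul, blk_mul, blk_mul]
    congr 1 <;> ring
  set A1 := Complex.exp ((α₁ : ℂ) * Complex.I) with hA1
  set A2 := Complex.exp ((α₂ : ℂ) * Complex.I) with hA2
  set B1 := Complex.exp ((β₁ : ℂ) * Complex.I) with hB1
  set B2 := Complex.exp ((β₂ : ℂ) * Complex.I) with hB2
  have hd : A1 * A2 * B1 * B2 * ((starRingEnd ℂ) A1 *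
      (p * (starRingEnd ℂ) B1 + (1 - p) * (starRingEnd ℂ) B2)) = A2 * ((1 - p) * B1 + p * B2) := by
    linear_combination A2 * B1 * B2 * (p * (starRingEnd ℂ) B1 + (1 - p) * (starRingEnd ℂ) B2) * ea1
      + A2 * B2 * p * eb1 + A2 * B1 * (1 - p) * eb2
  obtain ⟨R, hR, hRE⟩ := diagonalize (a := A1 * (p * B1 + (1 - p) * B2))
    (b := A1 * (c * s * (B1 - B2))) (x := -γ₁) (y := -γ₂) (by
      simp only [map_mul, map_add, map_sub, Complex.conj_ofReal, map_one]
      have k : (c : ℂ) * s * (c * s) = p * (1 - p) := by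
        linear_combination (s : ℂ) * s * hcc + (p : ℂ) * hss
      have inner_eq : (p * (starRingEnd ℂ) B1 + (1 - p) * (starRingEnd ℂ) B2)
          * (p * B1 + (1 - p) * B2)
          + c * s * (c * s) * (((starRingEnd ℂ) B1 - (starRingEnd ℂ) B2) * (B1 - B2)) = 1 := by
        linear_combination ((starRingEnd ℂ) B1 - (starRingEnd ℂ) B2) * (B1 - B2) * k
          + p * eb1 + (1 - p) * eb2
      linear_combination (starRingEnd ℂ) A1 * A1 * inner_eq + ea1) (by
      rw [← hdet, ← htr]
      simp only [map_mul, map_add, map_sub, Complex.conj_ofReal, map_one]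
      linear_combination hd)
  have hAB' : Emat α₁ α₂ * (blk c (-s) s c * Emat β₁ β₂ * (blk c (-s) s c)⁻¹) =
      R * Emat (-γ₁) (-γ₂) * R⁻¹ := by
    rw [hAB, ← hRE, ← hdet]
    simp only [map_mul, map_add, map_sub, Complex.conj_ofReal, map_one]
    congr 1
    · linear_combination A2 * B1 * B2 * c * s * ((starRingEnd ℂ) B1 - (starRingEnd ℂ) B2) * ea1
        + A2 * c * s * B2 * eb1 - A2 * c * s * B1 * eb2
    · exact hd.symm
  have hABC : Emat α₁ α₂ * (blk c (-s) s c * Emat β₁ β₂ * (blk c (-s) s c)⁻¹) *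
      (R * Emat γ₁ γ₂ * R⁻¹) = 1 := by
    rw [hAB']
    exact mul_eq_one_comm.1 (conj_mul_neg hR γ₁ γ₂)
  have hone : memU21 (1 : M3) := by simp [memU21]
  refine ⟨Emat α₁ α₂, blk c (-s) s c * Emat β₁ β₂ * (blk c (-s) s c)⁻¹, R * Emat γ₁ γ₂ * R⁻¹,
    u_E _ _, u_conj hQ _ _, u_conj hR _ _, ⟨1, hone, by simp⟩, ⟨_, hQ, rfl⟩, ⟨_, hR, rfl⟩,
    ⟨1, by rw [hABC, one_smul]⟩, ![0, 0, 1], ?_, ⟨1, ?_⟩, ⟨1, ?_⟩, ⟨1, ?_⟩, -1, by norm_num, ?_⟩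
  · intro h
    have := congrFun h 2
    simp at this
  · rw [one_smul, E_blk, blk_vec]
  · rw [one_smul, hQi, E_blk, blk_mul, blk_mul, blk_vec]
  · rw [one_smul]
    have h1 := mul_eq_one_comm.1 hABC
    have h2 := congrArg (· *ᵥ (![0, 0, 1] : Fin 3 → ℂ)) h1
    beta_reduce at h2
    rw [hAB, ← Matrix.mulVec_mulVec, blk_vec, Matrix.one_mulVec] at h2
    exact h2
  · simp [J3, dotProduct, Fin.sum_univ_three, Matrix.mulVec_diagonal]

/-- Spherical reducible walls in PU(2,1). -/
theorem spherical_reducible_walls :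
    {τ : Tri | memTo3 τ ∧ ∃ A B C : M3, memU21 A ∧ memU21 B ∧ memU21 C ∧
        ellType A τ.1.1 τ.1.2 ∧ ellType B τ.2.1.1 τ.2.1.2 ∧ ellType C τ.2.2.1 τ.2.2.2 ∧
        (∃ lam : ℂ, A * B * C = lam • (1 : M3)) ∧
        (∃ v : Fin 3 → ℂ, v ≠ 0 ∧
          (∃ a : ℂ, A.mulVec v = a • v) ∧ (∃ b : ℂ, B.mulVec v = b • v) ∧
          (∃ c : ℂ, C.mulVec v = c • v) ∧
          (∃ r : ℝ, r < 0 ∧ star v ⬝ᵥ J3.mulVec v = (r : ℂ)))} =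
      (Sig4 ∪ Sig6 ∪ Sig8) ∩ {τ : Tri | memTo3 τ} := by
  ext ⟨⟨α₁, α₂⟩, ⟨β₁, β₂⟩, ⟨γ₁, γ₂⟩⟩
  simp only [Set.mem_setOf_eq, Set.mem_inter_iff, Set.mem_union]
  constructor
  · rintro ⟨hT, A, B, C, -, -, -, ⟨P, hP, rfl⟩, ⟨Q, hQ, rfl⟩, ⟨R, hR, rfl⟩, ⟨lam, hlam⟩,
      v, hv0, ⟨a, ha⟩, ⟨b, hb⟩, ⟨c, hc⟩, r, hr, hf⟩
    refine ⟨?_, hT⟩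
    obtain ⟨⟨h1, h2, h3⟩, ⟨h4, h5, h6⟩, ⟨h7, h8, h9⟩⟩ := hT
    dsimp only at *
    have hm := (angle_main h1 h2 h3 h4 h5 h6 h7 h8 h9).1
      (forward h1 h2 h3 h4 h5 h6 h7 h8 h9 hP hQ hR hr hlam hv0 ha hb hc hf)
    have hT3 : memT3 ((α₁, α₂), (β₁, β₂), (γ₁, γ₂)) := by
      refine ⟨⟨?_, ?_, ?_, ?_, ?_⟩, ⟨?_, ?_, ?_, ?_, ?_⟩, ⟨?_, ?_, ?_, ?_, ?_⟩⟩ <;>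
        dsimp only <;> linarith
    rcases hm with hm | hm | hm
    · exact Or.inl (Or.inl ⟨hT3, by simpa [Sf, sg, coord] using hm⟩)
    · exact Or.inl (Or.inr ⟨hT3, by simpa [Sf, sg, coord] using hm⟩)
    · exact Or.inr ⟨hT3, by simpa [Sf, sg, coord] using hm⟩
  · rintro ⟨hm, hT⟩
    refine ⟨hT, ?_⟩
    obtain ⟨⟨h1, h2, h3⟩, ⟨h4, h5, h6⟩, ⟨h7, h8, h9⟩⟩ := hT
    dsimp only at *
    have hk := (angle_main h1 h2 h3 h4 h5 h6 h7 h8 h9).2 (by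
      rcases hm with (⟨-, hm⟩ | ⟨-, hm⟩) | ⟨-, hm⟩
      · exact Or.inl (by simpa [Sf, sg, coord] using hm)
      · exact Or.inr (Or.inl (by simpa [Sf, sg, coord] using hm))
      · exact Or.inr (Or.inr (by simpa [Sf, sg, coord] using hm)))
    exact backward hk.1 hk.2
end
end
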